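/- arXiv:1705.04372 — 4 statements merged into one kernel-verified Lean document; each statement's English description precedes it below -/
import Mathlib

section
/- (Hough–Nielsen.) Every covering system of the integers has a modulus divisible by 2 or by 3. That is, if S is a finite set of integers greater than 1, a : S → ℤ, and the union of the classes a_m mod m over m ∈ S equals ℤ, then there exists m ∈ S with 2 ∣ m or 3 ∣ m. -/
open Finset Function

/-- The average of `g` over `0, …, N - 1`. -/
noncomputable def avg (N : ℕ) (g : ℤ → ℝ) : ℝ := (∑ i ∈ range N, g i) / N

/-- The indicator function of the residue class of `a` modulo `m`. -/
def cls (m : ℕ) (a x : ℤ) : ℝ := if x ≡ a [ZMOD m] then 1 else 0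

lemma avg_mono {N : ℕ} {g h : ℤ → ℝ} (H : ∀ x, g x ≤ h x) : avg N g ≤ avg N h :=
  div_le_div_of_nonneg_right (sum_le_sum fun _ _ => H _) (Nat.cast_nonneg N)

lemma avg_nonneg {N : ℕ} {g : ℤ → ℝ} (H : ∀ x, 0 ≤ g x) : 0 ≤ avg N g :=
  div_nonneg (sum_nonneg fun _ _ => H _) (Nat.cast_nonneg N)

lemma avg_add (N : ℕ) (g h : ℤ → ℝ) : avg N (fun x => g x + h x) = avg N g + avg N h := by
  simp [avg, sum_add_distrib, add_div]

lemma avg_const_mul (N : ℕ) (c : ℝ) (g : ℤ → ℝ) : avg N (fun x => c * g x) = c * avg N g := by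
  simp [avg, ← mul_sum, mul_div_assoc]

lemma avg_mul_const (N : ℕ) (c : ℝ) (g : ℤ → ℝ) : avg N (fun x => g x * c) = avg N g * c := by
  simp only [mul_comm _ c, avg_const_mul]

lemma avg_div_const (N : ℕ) (c : ℝ) (g : ℤ → ℝ) : avg N (fun x => g x / c) = avg N g / c := by
  simp only [div_eq_mul_inv, avg_mul_const]

lemma avg_const {N : ℕ} (hN : N ≠ 0) (c : ℝ) : avg N (fun _ => c) = c := by
  have : (N : ℝ) ≠ 0 := by exact_mod_cast hN
  simp only [avg, sum_const, card_range, nsmul_eq_mul]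
  field_simp

lemma avg_sum {ι : Type*} (N : ℕ) (s : Finset ι) (g : ι → ℤ → ℝ) :
    avg N (fun x => ∑ i ∈ s, g i x) = ∑ i ∈ s, avg N (g i) := by
  simp only [avg]
  rw [sum_comm, sum_div]

lemma avg_shift {N : ℕ} {g : ℤ → ℝ} (hg : Periodic g (N : ℤ)) (c : ℕ) :
    avg N (fun x => g (x + c)) = avg N g := by
  induction c with
  | zero => simp
  | succ c ih =>
    rw [← ih]
    have h1 := sum_range_succ (fun i : ℕ => g (i + c)) N
    have h2 := sum_range_succ' (fun i : ℕ => g (i + c)) N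
    have h3 : g (N + c) = g c := by rw [add_comm]; exact hg _
    simp only [avg]
    congr 1
    rw [h1, h3] at h2
    simp only [Nat.cast_zero, zero_add, add_left_inj] at h2
    rw [h2]
    refine sum_congr rfl fun i _ => ?_
    push_cast
    ring_nf

lemma periodic_of_dvd {g : ℤ → ℝ} {R N : ℕ} (hg : Periodic g (R : ℤ)) (h : R ∣ N) :
    Periodic g (N : ℤ) := by
  obtain ⟨k, rfl⟩ := h
  have := hg.nat_mul k
  push_cast
  rwa [mul_comm]

lemma Function.Periodic.add_cast_mul {g : ℤ → ℝ} {R : ℕ} (hg : Periodic g (R : ℤ)) (x t : ℤ) :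
    g (x + R * t) = g x := by
  rw [mul_comm]; exact hg.int_mul t x

lemma cls_periodic (m : ℕ) (a : ℤ) : Periodic (cls m a) (m : ℤ) := fun x => by
  simp [cls]

lemma cls_nonneg (m : ℕ) (a x : ℤ) : 0 ≤ cls m a x := by
  unfold cls; split_ifs <;> norm_num

lemma cls_le_one (m : ℕ) (a x : ℤ) : cls m a x ≤ 1 := by
  unfold cls; split_ifs <;> norm_num

lemma cls_mul {m k : ℕ} (h : m.Coprime k) (a x : ℤ) :
    cls (m * k) a x = cls m a x * cls k a x := by
  have : x ≡ a [ZMOD (m * k : ℕ)] ↔ x ≡ a [ZMOD m] ∧ x ≡ a [ZMOD k] := by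
    push_cast
    rw [Int.modEq_and_modEq_iff_modEq_mul (by simpa using h)]
  simp only [cls, this, ite_and]
  split_ifs <;> simp

/-- The average of `g` over the fibre `x, x + R, …, x + (q - 1) R`. -/
noncomputable def fibreAvg (R q : ℕ) (g : ℤ → ℝ) (x : ℤ) : ℝ := avg q fun t => g (x + R * t)

lemma avg_fibreAvg {N R q : ℕ} (hq : q ≠ 0) {g : ℤ → ℝ} (hg : Periodic g (N : ℤ)) :
    avg N (fibreAvg R q g) = avg N g := by
  have : ∀ t : ℕ, avg N (fun x => g (x + R * (t : ℤ))) = avg N g := fun t => by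
    simpa using avg_shift hg (R * t)
  have hq' : (q : ℝ) ≠ 0 := by exact_mod_cast hq
  calc avg N (fibreAvg R q g)
      = avg N (fun x => (∑ t ∈ range q, g (x + R * (t : ℤ))) / q) := rfl
    _ = (∑ t ∈ range q, avg N (fun x => g (x + R * (t : ℤ)))) / q := by
        rw [avg_div_const, avg_sum]
    _ = avg N g := by
        simp only [this, sum_const, card_range, nsmul_eq_mul]
        field_simp

lemma fibreAvg_mul_left {R q : ℕ} {h : ℤ → ℝ} (hh : Periodic h (R : ℤ)) (g : ℤ → ℝ) (x : ℤ) :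
    fibreAvg R q (fun y => h y * g y) x = h x * fibreAvg R q g x := by
  simp only [fibreAvg, hh.add_cast_mul, avg_const_mul]

lemma avg_mul_fibreAvg {N R q : ℕ} (hq : q ≠ 0) {h g : ℤ → ℝ} (hh : Periodic h (R : ℤ))
    (hg : Periodic g ((R * q : ℕ) : ℤ)) (hN : R * q ∣ N) :
    avg N (fun x => h x * g x) = avg N (fun x => h x * fibreAvg R q g x) := by
  rw [← avg_fibreAvg (R := R) hq (periodic_of_dvd (fun x => ?_) hN)]
  · exact congrArg _ (funext fun x => fibreAvg_mul_left hh g x)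
  · simp only [hg x, periodic_of_dvd hh (dvd_mul_right R q) x]

lemma fibreAvg_periodic {R q : ℕ} {g : ℤ → ℝ} (hg : Periodic g ((R * q : ℕ) : ℤ)) :
    Periodic (fibreAvg R q g) (R : ℤ) := fun x => by
  have : Periodic (fun t : ℤ => g (x + R * t)) (q : ℤ) := fun t => by
    have := hg (x + R * t)
    push_cast at this
    simp only [← this]
    ring_nf
  rw [fibreAvg, fibreAvg, ← avg_shift this 1]
  congr 1
  funext t
  push_cast
  ring_nf

lemma sum_cls_add_mul {R k : ℕ} (hk : k ≠ 0) (h : R.Coprime k) (a x : ℤ) :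
    ∑ t ∈ range k, cls k a (x + R * (t : ℤ)) = 1 := by
  have hk0 : (0 : ℤ) < k := by exact_mod_cast Nat.pos_of_ne_zero hk
  obtain ⟨u, v, huv⟩ : IsCoprime (R : ℤ) k := by exact_mod_cast h
  have hR : ∀ y : ℤ, R * (u * y) ≡ y [ZMOD k] := fun y => by
    refine (Int.modEq_iff_dvd.2 ⟨v * y, ?_⟩)
    linear_combination (-y) * huv
  rw [sum_eq_single ((u * (a - x)) % k).toNat]
  · rw [cls, if_pos]
    rw [Int.toNat_of_nonneg (Int.emod_nonneg _ hk0.ne')]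
    have h1 : R * (u * (a - x) % k) ≡ R * (u * (a - x)) [ZMOD k] :=
      (Int.mod_modEq _ _).mul_left _
    simpa using (h1.trans (hR _)).add_left x
  · intro t ht hne
    rw [cls, if_neg]
    intro hmod
    apply hne
    have h1 : R * (t : ℤ) ≡ a - x [ZMOD k] := by
      simpa using hmod.sub_right x
    have h2 : (t : ℤ) ≡ u * (a - x) [ZMOD k] := by
      have := h1.mul_left u
      refine Int.ModEq.trans ?_ this
      have := (hR t).symm
      convert this using 1
      ring
    have h3 : (t : ℤ) = u * (a - x) % k := by
      rw [← h2.eq, Int.emod_eq_of_lt (by positivity) (by exact_mod_cast mem_range.1 ht)]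
    omega
  · intro hnot
    exfalso
    apply hnot
    have h1 := Int.emod_lt_of_pos (u * (a - x)) hk0
    have h2 := Int.emod_nonneg (u * (a - x)) hk0.ne'
    rw [mem_range]
    omega

lemma fibreAvg_cls {R k : ℕ} (hk : k ≠ 0) (h : R.Coprime k) (a x : ℤ) :
    fibreAvg R k (cls k a) x = 1 / k := by
  rw [fibreAvg, avg, sum_cls_add_mul hk h]

lemma fibreAvg_cls_of_dvd {R k q : ℕ} (hq : q ≠ 0) (hkq : k ∣ q) (h : R.Coprime k) (a x : ℤ) :
    fibreAvg R q (cls k a) x = 1 / k := by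
  have hk : k ≠ 0 := ne_zero_of_dvd_ne_zero hq hkq
  have hp : Periodic (fun t : ℤ => cls k a (x + R * t)) (k : ℤ) := fun t => by
    have := (cls_periodic k a).add_cast_mul (x + R * t) R
    simp only [← this]
    ring_nf
  rw [fibreAvg, ← avg_fibreAvg (R := 1) hk (periodic_of_dvd hp hkq), ← avg_const hq (1 / (k : ℝ))]
  congr 1
  funext t
  rw [← fibreAvg_cls hk h a (x + R * t)]
  simp only [fibreAvg]
  congr 1
  funext s
  push_cast
  ring_nf

lemma avg_mul_cls {N R k : ℕ} (hk : k ≠ 0) (h : R.Coprime k) (hN : R * k ∣ N) {g : ℤ → ℝ}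
    (hg : Periodic g (R : ℤ)) (a : ℤ) : avg N (fun x => g x * cls k a x) = avg N g / k := by
  rw [avg_mul_fibreAvg hk hg (periodic_of_dvd (cls_periodic k a) (dvd_mul_left k R)) hN,
    ← avg_div_const]
  congr 1
  funext x
  rw [fibreAvg_cls hk h, mul_one_div]

/-- The distortion step: reweight each fibre so as to avoid most of `B`. -/
lemma exists_distortion {R q : ℕ} (hq : q ≠ 0) {B : ℤ → ℝ} (hB : ∀ x, B x = 0 ∨ B x = 1)
    (hBp : Periodic B ((R * q : ℕ) : ℤ)) :
    ∃ φ : ℤ → ℝ, (∀ x, 0 ≤ φ x) ∧ (∀ x, φ x ≤ 4 / 3) ∧ Periodic φ ((R * q : ℕ) : ℤ) ∧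
      (∀ x, fibreAvg R q φ x = 1) ∧
      ∀ x, fibreAvg R q (fun y => B y * φ y) x ≤ 4 / 3 * fibreAvg R q B x ^ 2 := by
  set α := fibreAvg R q B with hα
  have hαp : Periodic α (R : ℤ) := fibreAvg_periodic hBp
  have hα0 : ∀ x, 0 ≤ α x := fun x => avg_nonneg fun y => by
    rcases hB (x + R * y) with h | h <;> simp [h]
  let u : ℤ → ℝ := fun x => if α x < 1 / 4 then 1 / (1 - α x) else 4 / 3
  let v : ℤ → ℝ := fun x => if α x < 1 / 4 then - (1 / (1 - α x)) else - (1 / (3 * α x))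
  have hup : Periodic u (R : ℤ) := fun x => by simp only [u, hαp x]
  have hvp : Periodic v (R : ℤ) := fun x => by simp only [v, hαp x]
  have hfib : ∀ x, fibreAvg R q (fun y => u y + v y * B y) x = u x + v x * α x := fun x => by
    simp only [fibreAvg, hup.add_cast_mul, hvp.add_cast_mul, avg_add, avg_const_mul, avg_const hq,
      hα]
  refine ⟨fun x => u x + v x * B x, fun x => ?_, fun x => ?_, fun x => ?_, fun x => ?_,
    fun x => ?_⟩
  · simp only [u, v]
    split_ifs with h
    · have : 0 < 1 / (1 - α x) := by apply one_div_pos.2; linarith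
      rcases hB x with h | h <;> rw [h] <;> linarith
    · have : 1 / (3 * α x) ≤ 4 / 3 := by
        rw [div_le_div_iff₀ (by linarith) (by norm_num)]; linarith
      rcases hB x with h | h <;> rw [h] <;> linarith
  · simp only [u, v]
    split_ifs with h
    · have h1 : 1 / (1 - α x) ≤ 4 / 3 := by
        rw [div_le_div_iff₀ (by linarith) (by norm_num)]; linarith
      have : 0 < 1 / (1 - α x) := by apply one_div_pos.2; linarith
      rcases hB x with h | h <;> rw [h] <;> linarith
    · have : 0 < 1 / (3 * α x) := by apply one_div_pos.2; linarith
      rcases hB x with h | h <;> rw [h] <;> linarith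
  · simp only [periodic_of_dvd hup (dvd_mul_right R q) x,
      periodic_of_dvd hvp (dvd_mul_right R q) x, hBp x]
  · rw [hfib]
    simp only [u, v]
    split_ifs with h
    · have : 1 - α x ≠ 0 := by linarith
      field_simp
      ring
    · have : α x ≠ 0 := by linarith
      field_simp
      ring
  · have h1 : fibreAvg R q (fun y => B y * (u y + v y * B y)) x = (u x + v x) * α x := by
      rw [← fibreAvg_mul_left (h := fun y => u y + v y)
        (fun y => by simp only [hup y, hvp y])]
      congr 1
      funext y
      rcases hB y with h | h <;> rw [h] <;> ring
    rw [h1]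
    simp only [u, v]
    split_ifs with h
    · have := sq_nonneg (α x)
      simp only [add_neg_cancel, zero_mul]
      positivity
    · have : α x ≠ 0 := by linarith
      have h2 : (4 / 3 + -(1 / (3 * α x))) * α x = 4 / 3 * α x - 1 / 3 := by
        field_simp
        ring
      rw [h2]
      nlinarith [sq_nonneg (α x - 1 / 2)]

lemma sum_divisors_mul_prime_pow {R p e : ℕ} (hp : p.Prime) (hR : ¬ p ∣ R) (F : ℕ → ℝ) :
    ∑ M ∈ (R * p ^ e).divisors, F M = ∑ j ∈ range (e + 1), ∑ m ∈ R.divisors, F (m * p ^ j) := by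
  have hc : R.Coprime (p ^ e) := ((hp.coprime_iff_not_dvd.2 hR).symm).pow_right e
  rw [sum_comm, Nat.divisors_mul, ← image_mul_product, sum_image, sum_product]
  · simp only [Nat.sum_divisors_prime_pow hp]
  · exact hc.mul_injOn_divisors

lemma exists_mul_prime_pow_of_dvd {R p e d : ℕ} (hp : p.Prime) (hd : d ∣ R * p ^ e)
    (hdR : ¬ d ∣ R) : ∃ m j, m ∣ R ∧ 1 ≤ j ∧ j ≤ e ∧ d = m * p ^ j := by
  obtain ⟨m, k, hm, hk, rfl⟩ := exists_dvd_and_dvd_of_dvd_mul hd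
  obtain ⟨j, hj, rfl⟩ := (Nat.dvd_prime_pow hp).1 hk
  refine ⟨m, j, hm, Nat.one_le_iff_ne_zero.2 ?_, hj, rfl⟩
  rintro rfl
  exact hdR (by simpa using hm)

lemma sum_inv_pow_le {p : ℝ} (hp : 1 < p) (e : ℕ) :
    ∑ j ∈ Icc 1 e, 1 / p ^ j ≤ 1 / (p - 1) := by
  have h0 : 0 < p - 1 := by linarith
  have key : ∑ j ∈ Icc 1 e, 1 / p ^ j = 1 / (p - 1) - 1 / (p ^ e * (p - 1)) := by
    induction e with
    | zero => simp
    | succ e ih =>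
      rw [sum_Icc_succ_top (by omega), ih]
      field_simp
      ring
  rw [key]
  have : 0 < 1 / (p ^ e * (p - 1)) := by positivity
  linarith

/-- The factor lost on a pair of classes whose moduli have `p`-parts `p ^ j` and `p ^ k`. -/
noncomputable def pairFactor (p : ℝ) (j k : ℕ) : ℝ :=
  if max j k = 0 then 1 else 4 / 3 * (1 / p ^ max j k)

lemma pairFactor_nonneg {p : ℝ} (hp : 1 < p) (j k : ℕ) : 0 ≤ pairFactor p j k := by
  unfold pairFactor; split_ifs <;> positivity

lemma sum_pairFactor_le {p : ℝ} (hp : 1 < p) (e : ℕ) :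
    ∑ j ∈ range (e + 1), ∑ k ∈ range (e + 1), pairFactor p j k ≤
      1 + 4 / 3 * ((3 * p - 1) / (p - 1) ^ 2) := by
  have h0 : 0 < p - 1 := by linarith
  have key : ∑ j ∈ range (e + 1), ∑ k ∈ range (e + 1), pairFactor p j k =
      1 + 4 / 3 * ((3 * p - 1) / (p - 1) ^ 2
        - 1 / p ^ e * (2 * e / (p - 1) + (3 * p - 1) / (p - 1) ^ 2)) := by
    induction e with
    | zero => simp [pairFactor]
    | succ e ih =>
      have hr : ∀ j ∈ range (e + 1), pairFactor p j (e + 1) = 4 / 3 * (1 / p ^ (e + 1)) := by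
        intro j hj
        rw [mem_range] at hj
        simp [pairFactor, max_eq_right hj.le]
      have hl : ∀ j ∈ range (e + 1), pairFactor p (e + 1) j = 4 / 3 * (1 / p ^ (e + 1)) := by
        intro j hj
        rw [mem_range] at hj
        simp [pairFactor, max_eq_left hj.le]
      have hd : pairFactor p (e + 1) (e + 1) = 4 / 3 * (1 / p ^ (e + 1)) := by
        simp [pairFactor]
      rw [sum_range_succ _ (e + 1), sum_congr rfl (fun j _ => sum_range_succ _ (e + 1)),
        sum_add_distrib, ih, sum_congr rfl hr, sum_range_succ _ (e + 1), sum_congr rfl hl, hd]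
      simp only [sum_const, card_range, nsmul_eq_mul]
      push_cast
      field_simp
      ring
  rw [key]
  have h1 : 0 ≤ 1 / p ^ e * (2 * e / (p - 1) + (3 * p - 1) / (p - 1) ^ 2) := by
    have : 0 < 3 * p - 1 := by linarith
    positivity
  linarith

open Classical in
/-- The indicator of the union of the classes `a d` modulo `d` with `d ∈ S` and `d ∣ R`. -/
noncomputable def covered (S : Finset ℕ) (a : ℕ → ℤ) (R : ℕ) (x : ℤ) : ℝ :=
  if ∃ d ∈ S, d ∣ R ∧ x ≡ a d [ZMOD d] then 1 else 0

/-- There is a probability density on `ℤ / R` whose total mass on pairs of classes is at most `V`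
and which gives mass at most `σ` to the integers covered by the moduli dividing `R`. -/
def HasDensity (S : Finset ℕ) (a : ℕ → ℤ) (N R : ℕ) (V σ : ℝ) : Prop :=
  ∃ f : ℤ → ℝ, (∀ x, 0 ≤ f x) ∧ Periodic f (R : ℤ) ∧ avg N f = 1 ∧
    (∀ b c : ℕ → ℕ → ℤ, ∑ m ∈ R.divisors, ∑ n ∈ R.divisors,
      avg N (fun x => f x * (cls m (b m n) x * cls n (c m n) x)) ≤ V) ∧
    avg N (fun x => f x * covered S a R x) ≤ σ

lemma cls_modEq_periodic {d R : ℕ} (h : d ∣ R) (a x : ℤ) :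
    x + R ≡ a [ZMOD d] ↔ x ≡ a [ZMOD d] := by
  have : x + R ≡ x [ZMOD d] := by
    rw [Int.modEq_iff_dvd]
    simpa using (by exact_mod_cast h : (d : ℤ) ∣ R)
  exact ⟨fun h => this.symm.trans h, fun h => this.trans h⟩

lemma covered_periodic (S : Finset ℕ) (a : ℕ → ℤ) (R : ℕ) :
    Periodic (covered S a R) (R : ℤ) := fun x => by
  have : (∃ d ∈ S, d ∣ R ∧ x + R ≡ a d [ZMOD d]) ↔ ∃ d ∈ S, d ∣ R ∧ x ≡ a d [ZMOD d] :=
    exists_congr fun d => and_congr_right fun _ => and_congr_right fun h =>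
      cls_modEq_periodic h _ _
  simp only [covered, this]

open Classical in
/-- The indicator of the union of the classes whose modulus divides `R * q` but not `R`. -/
noncomputable def newlyCovered (S : Finset ℕ) (a : ℕ → ℤ) (R q : ℕ) (x : ℤ) : ℝ :=
  if ∃ d ∈ S, d ∣ R * q ∧ ¬ d ∣ R ∧ x ≡ a d [ZMOD d] then 1 else 0

lemma newlyCovered_periodic (S : Finset ℕ) (a : ℕ → ℤ) (R q : ℕ) :
    Periodic (newlyCovered S a R q) ((R * q : ℕ) : ℤ) := fun x => by
  have : (∃ d ∈ S, d ∣ R * q ∧ ¬ d ∣ R ∧ x + (R * q : ℕ) ≡ a d [ZMOD d]) ↔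
      ∃ d ∈ S, d ∣ R * q ∧ ¬ d ∣ R ∧ x ≡ a d [ZMOD d] :=
    exists_congr fun d => and_congr_right fun _ => and_congr_right fun h =>
      and_congr_right fun _ => cls_modEq_periodic h _ _
  simp only [newlyCovered, this]

lemma newlyCovered_eq (S : Finset ℕ) (a : ℕ → ℤ) (R q : ℕ) (x : ℤ) :
    newlyCovered S a R q x = 0 ∨ newlyCovered S a R q x = 1 := by
  unfold newlyCovered; split_ifs <;> simp

lemma covered_mul_le (S : Finset ℕ) (a : ℕ → ℤ) (R q : ℕ) (x : ℤ) :
    covered S a (R * q) x ≤ covered S a R x + newlyCovered S a R q x := by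
  by_cases h : ∃ d ∈ S, d ∣ R * q ∧ x ≡ a d [ZMOD d]
  · obtain ⟨d, hd, hdq, hx⟩ := h
    rw [covered, if_pos ⟨d, hd, hdq, hx⟩]
    by_cases hdR : d ∣ R
    · rw [covered, if_pos ⟨d, hd, hdR, hx⟩]
      rcases newlyCovered_eq S a R q x with h | h <;> rw [h] <;> norm_num
    · rw [newlyCovered, if_pos ⟨d, hd, hdq, hdR, hx⟩, covered]
      split_ifs <;> norm_num
  · rw [covered, if_neg h, covered]
    rcases newlyCovered_eq S a R q x with h | h <;> rw [h] <;> split_ifs <;> norm_num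

lemma newlyCovered_le {S : Finset ℕ} {R p e : ℕ} (hp : p.Prime) (hR0 : R ≠ 0)
    (a : ℕ → ℤ) (x : ℤ) :
    newlyCovered S a R (p ^ e) x ≤
      ∑ j ∈ Icc 1 e, ∑ m ∈ R.divisors, cls (m * p ^ j) (a (m * p ^ j)) x := by
  have hn : ∀ j ∈ Icc 1 e, 0 ≤ ∑ m ∈ R.divisors, cls (m * p ^ j) (a (m * p ^ j)) x :=
    fun j _ => sum_nonneg fun m _ => cls_nonneg _ _ _
  unfold newlyCovered
  split_ifs with h
  · obtain ⟨d, -, hd, hdR, hx⟩ := h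
    obtain ⟨m, j, hm, hj1, hje, rfl⟩ := exists_mul_prime_pow_of_dvd hp hd hdR
    refine le_trans ?_ (single_le_sum hn (mem_Icc.2 ⟨hj1, hje⟩))
    refine le_trans ?_ (single_le_sum (fun m _ => cls_nonneg _ _ _)
      (Nat.mem_divisors.2 ⟨hm, hR0⟩))
    rw [cls, if_pos hx]
  · exact sum_nonneg hn

lemma fibreAvg_newlyCovered_le {S : Finset ℕ} {R p e : ℕ} (hp : p.Prime) (hR : ¬ p ∣ R)
    (a : ℕ → ℤ) (x : ℤ) :
    fibreAvg R (p ^ e) (newlyCovered S a R (p ^ e)) x ≤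
      ∑ j ∈ Icc 1 e, 1 / (p : ℝ) ^ j * ∑ m ∈ R.divisors, cls m (a (m * p ^ j)) x := by
  have hR0 : R ≠ 0 := by rintro rfl; simp at hR
  have hpR : p.Coprime R := hp.coprime_iff_not_dvd.2 hR
  have hq : p ^ e ≠ 0 := pow_ne_zero _ hp.ne_zero
  calc fibreAvg R (p ^ e) (newlyCovered S a R (p ^ e)) x
      ≤ fibreAvg R (p ^ e)
        (fun y => ∑ j ∈ Icc 1 e, ∑ m ∈ R.divisors, cls (m * p ^ j) (a (m * p ^ j)) y) x :=
        avg_mono fun t => newlyCovered_le hp hR0 a _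
    _ = ∑ j ∈ Icc 1 e, ∑ m ∈ R.divisors,
          fibreAvg R (p ^ e) (fun y => cls (m * p ^ j) (a (m * p ^ j)) y) x := by
        simp only [fibreAvg, avg_sum]
    _ = ∑ j ∈ Icc 1 e, 1 / (p : ℝ) ^ j * ∑ m ∈ R.divisors, cls m (a (m * p ^ j)) x := by
        refine sum_congr rfl fun j hj => ?_
        rw [mul_sum]
        refine sum_congr rfl fun m hm => ?_
        have hmR := Nat.dvd_of_mem_divisors hm
        have hc : m.Coprime (p ^ j) := (hpR.symm.coprime_dvd_left hmR).pow_right j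
        simp only [cls_mul hc]
        rw [fibreAvg_mul_left (periodic_of_dvd (cls_periodic m _) hmR),
          fibreAvg_cls_of_dvd hq (pow_dvd_pow p (mem_Icc.1 hj).2) (hpR.symm.pow_right j)]
        push_cast
        ring

lemma avg_mul_fibreAvg_newlyCovered_sq_le {S : Finset ℕ} {a : ℕ → ℤ} {N R p e : ℕ} {V : ℝ}
    {f : ℤ → ℝ} (hp : p.Prime) (hR : ¬ p ∣ R) (hf0 : ∀ x, 0 ≤ f x)
    (hV : ∀ b c : ℕ → ℕ → ℤ, ∑ m ∈ R.divisors, ∑ n ∈ R.divisors,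
      avg N (fun x => f x * (cls m (b m n) x * cls n (c m n) x)) ≤ V) :
    avg N (fun x => f x * fibreAvg R (p ^ e) (newlyCovered S a R (p ^ e)) x ^ 2) ≤
      V / ((p : ℝ) - 1) ^ 2 := by
  have hp1 : (1 : ℝ) < p := by exact_mod_cast hp.one_lt
  have hV0 : 0 ≤ V := le_trans (sum_nonneg fun m _ => sum_nonneg fun n _ => avg_nonneg fun x =>
    mul_nonneg (hf0 x) (mul_nonneg (cls_nonneg _ _ _) (cls_nonneg _ _ _)))
    (hV (fun _ _ => 0) (fun _ _ => 0))
  have hα0 : ∀ x, 0 ≤ fibreAvg R (p ^ e) (newlyCovered S a R (p ^ e)) x := fun x =>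
    avg_nonneg fun y => by
      rcases newlyCovered_eq S a R (p ^ e) (x + R * y) with h | h <;> simp [h]
  calc avg N (fun x => f x * fibreAvg R (p ^ e) (newlyCovered S a R (p ^ e)) x ^ 2)
      ≤ avg N (fun x => f x *
          (∑ j ∈ Icc 1 e, 1 / (p : ℝ) ^ j * ∑ m ∈ R.divisors, cls m (a (m * p ^ j)) x) ^ 2) :=
        avg_mono fun x => mul_le_mul_of_nonneg_left
          (pow_le_pow_left₀ (hα0 x) (fibreAvg_newlyCovered_le hp hR a x) 2) (hf0 x)
    _ = ∑ j ∈ Icc 1 e, ∑ k ∈ Icc 1 e, 1 / (p : ℝ) ^ j * (1 / (p : ℝ) ^ k) *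
          ∑ m ∈ R.divisors, ∑ n ∈ R.divisors,
            avg N (fun x => f x * (cls m (a (m * p ^ j)) x * cls n (a (n * p ^ k)) x)) := by
        simp only [← avg_const_mul, ← avg_sum]
        congr 1
        funext x
        rw [sq, sum_mul_sum, mul_sum]
        refine sum_congr rfl fun j _ => ?_
        rw [mul_sum]
        refine sum_congr rfl fun k _ => ?_
        rw [mul_mul_mul_comm, sum_mul_sum, mul_left_comm, mul_sum]
        congr 1
        refine sum_congr rfl fun m _ => ?_
        rw [mul_sum]
    _ ≤ ∑ j ∈ Icc 1 e, ∑ k ∈ Icc 1 e, 1 / (p : ℝ) ^ j * (1 / (p : ℝ) ^ k) * V :=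
        sum_le_sum fun j _ => sum_le_sum fun k _ => mul_le_mul_of_nonneg_left
          (hV (fun m _ => a (m * p ^ j)) (fun _ n => a (n * p ^ k))) (by positivity)
    _ = (∑ j ∈ Icc 1 e, 1 / (p : ℝ) ^ j) ^ 2 * V := by
        rw [sq, sum_mul_sum, sum_mul]
        exact sum_congr rfl fun j _ => (sum_mul _ _ _).symm
    _ ≤ (1 / ((p : ℝ) - 1)) ^ 2 * V :=
        mul_le_mul_of_nonneg_right (pow_le_pow_left₀ (sum_nonneg fun j _ => by positivity)
          (sum_inv_pow_le hp1 e) 2) hV0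
    _ = V / ((p : ℝ) - 1) ^ 2 := by
        rw [div_pow, one_pow, one_div_mul_eq_div]

lemma cls_mul_cls_le {m n p j k : ℕ} (hm : m.Coprime p) (hn : n.Coprime p) (b c : ℤ) :
    ∃ d : ℤ, ∀ x, cls (m * p ^ j) b x * cls (n * p ^ k) c x ≤
      cls m b x * cls n c x * cls (p ^ max j k) d x := by
  rcases le_total j k with h | h
  · refine ⟨c, fun x => ?_⟩
    rw [max_eq_right h, cls_mul (hm.pow_right j), cls_mul (hn.pow_right k)]
    have h1 := cls_le_one (p ^ j) b x
    have h2 : 0 ≤ cls m b x * (cls n c x * cls (p ^ k) c x) :=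
      mul_nonneg (cls_nonneg _ _ _) (mul_nonneg (cls_nonneg _ _ _) (cls_nonneg _ _ _))
    nlinarith
  · refine ⟨b, fun x => ?_⟩
    rw [max_eq_left h, cls_mul (hm.pow_right j), cls_mul (hn.pow_right k)]
    have h1 := cls_le_one (p ^ k) c x
    have h2 : 0 ≤ cls m b x * cls (p ^ j) b x * cls n c x :=
      mul_nonneg (mul_nonneg (cls_nonneg _ _ _) (cls_nonneg _ _ _)) (cls_nonneg _ _ _)
    nlinarith

lemma avg_mul_cls_mul_cls_le {N R p e m n j k : ℕ} {f φ : ℤ → ℝ} (hp : p.Prime) (hR : ¬ p ∣ R)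
    (hN : R * p ^ e ∣ N) (hf0 : ∀ x, 0 ≤ f x) (hf : Periodic f (R : ℤ))
    (hφ : ∀ x, φ x ≤ 4 / 3) (hφp : Periodic φ ((R * p ^ e : ℕ) : ℤ))
    (hφ1 : ∀ x, fibreAvg R (p ^ e) φ x = 1) (hm : m ∣ R) (hn : n ∣ R) (hj : j ≤ e) (hk : k ≤ e)
    (b c : ℤ) :
    avg N (fun x => f x * φ x * (cls (m * p ^ j) b x * cls (n * p ^ k) c x)) ≤
      pairFactor p j k * avg N (fun x => f x * (cls m b x * cls n c x)) := by
  have hpR : R.Coprime p := (hp.coprime_iff_not_dvd.2 hR).symm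
  have hq : ∀ i, p ^ i ≠ 0 := fun i => pow_ne_zero _ hp.ne_zero
  have hper : Periodic (fun x => f x * (cls m b x * cls n c x)) (R : ℤ) := fun x => by
    simp only [hf x, periodic_of_dvd (cls_periodic m b) hm x,
      periodic_of_dvd (cls_periodic n c) hn x]
  unfold pairFactor
  split_ifs with h
  · obtain ⟨rfl, rfl⟩ : j = 0 ∧ k = 0 := by omega
    have := avg_mul_fibreAvg (hq e) hper hφp hN
    simp only [hφ1, mul_one] at this
    rw [one_mul, ← this]
    refine le_of_eq (congrArg _ (funext fun x => ?_))
    simp only [pow_zero, mul_one]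
    ring
  · obtain ⟨d, hd⟩ := cls_mul_cls_le (j := j) (k := k) (hpR.coprime_dvd_left hm)
      (hpR.coprime_dvd_left hn) b c
    have hNd : R * p ^ max j k ∣ N :=
      (mul_dvd_mul_left R (pow_dvd_pow p (max_le hj hk))).trans hN
    calc avg N (fun x => f x * φ x * (cls (m * p ^ j) b x * cls (n * p ^ k) c x))
        ≤ avg N (fun x => 4 / 3 * (f x * (cls m b x * cls n c x) * cls (p ^ max j k) d x)) := by
          refine avg_mono fun x => ?_
          have h1 : f x * φ x ≤ 4 / 3 * f x := by nlinarith [hf0 x, hφ x]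
          have h2 : 0 ≤ cls (m * p ^ j) b x * cls (n * p ^ k) c x :=
            mul_nonneg (cls_nonneg _ _ _) (cls_nonneg _ _ _)
          calc _ ≤ 4 / 3 * f x * (cls (m * p ^ j) b x * cls (n * p ^ k) c x) :=
                mul_le_mul_of_nonneg_right h1 h2
            _ ≤ 4 / 3 * f x * (cls m b x * cls n c x * cls (p ^ max j k) d x) :=
                mul_le_mul_of_nonneg_left (hd x) (by have := hf0 x; positivity)
            _ = _ := by ring
      _ = 4 / 3 * (1 / (p : ℝ) ^ max j k) * avg N (fun x => f x * (cls m b x * cls n c x)) := by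
          rw [avg_const_mul, avg_mul_cls (hq _) (hpR.pow_right _) hNd hper]
          push_cast
          ring

lemma HasDensity.mul_prime_pow {S : Finset ℕ} {a : ℕ → ℤ} {N R p e : ℕ} {V σ : ℝ}
    (H : HasDensity S a N R V σ) (hp : p.Prime) (hR : ¬ p ∣ R) (hN : R * p ^ e ∣ N) :
    HasDensity S a N (R * p ^ e) (V * (1 + 4 / 3 * ((3 * p - 1) / ((p : ℝ) - 1) ^ 2)))
      (σ + 4 / 3 * (V / ((p : ℝ) - 1) ^ 2)) := by
  obtain ⟨f, hf0, hf, hf1, hV, hσ⟩ := H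
  have hp1 : (1 : ℝ) < p := by exact_mod_cast hp.one_lt
  have hq : p ^ e ≠ 0 := pow_ne_zero _ hp.ne_zero
  obtain ⟨φ, hφ0, hφ, hφp, hφ1, hφB⟩ := exists_distortion hq (newlyCovered_eq S a R (p ^ e))
    (newlyCovered_periodic S a R (p ^ e))
  have hV0 : 0 ≤ V := le_trans (sum_nonneg fun m _ => sum_nonneg fun n _ => avg_nonneg fun x =>
    mul_nonneg (hf0 x) (mul_nonneg (cls_nonneg _ _ _) (cls_nonneg _ _ _)))
    (hV (fun _ _ => 0) (fun _ _ => 0))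
  have hff0 : ∀ x, 0 ≤ f x * φ x := fun x => mul_nonneg (hf0 x) (hφ0 x)
  have hpres : ∀ h : ℤ → ℝ, Periodic h (R : ℤ) →
      avg N (fun x => f x * φ x * h x) = avg N (fun x => f x * h x) := fun h hh => by
    have := avg_mul_fibreAvg hq (h := fun x => f x * h x) (fun x => by simp only [hf x, hh x])
      hφp hN
    simp only [hφ1, mul_one] at this
    rw [← this]
    exact congrArg _ (funext fun x => by ring)
  refine ⟨fun x => f x * φ x, hff0, fun x => ?_, ?_, fun b c => ?_, ?_⟩
  · simp only [hφp x, periodic_of_dvd hf (dvd_mul_right R (p ^ e)) x]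
  · simpa [hf1] using hpres (fun _ => 1) (fun _ => rfl)
  · calc ∑ m ∈ (R * p ^ e).divisors, ∑ n ∈ (R * p ^ e).divisors,
          avg N (fun x => f x * φ x * (cls m (b m n) x * cls n (c m n) x))
        = ∑ j ∈ range (e + 1), ∑ k ∈ range (e + 1), ∑ m ∈ R.divisors, ∑ n ∈ R.divisors,
          avg N (fun x => f x * φ x * (cls (m * p ^ j) (b (m * p ^ j) (n * p ^ k)) x *
            cls (n * p ^ k) (c (m * p ^ j) (n * p ^ k)) x)) := by
          simp only [sum_divisors_mul_prime_pow hp hR]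
          exact sum_congr rfl fun j _ => sum_comm
      _ ≤ ∑ j ∈ range (e + 1), ∑ k ∈ range (e + 1), pairFactor p j k * V := by
          refine sum_le_sum fun j hj => sum_le_sum fun k hk => ?_
          refine le_trans ?_ (mul_le_mul_of_nonneg_left
            (hV (fun m n => b (m * p ^ j) (n * p ^ k)) (fun m n => c (m * p ^ j) (n * p ^ k)))
            (pairFactor_nonneg hp1 j k))
          rw [mul_sum]
          refine sum_le_sum fun m hm => ?_
          rw [mul_sum]
          refine sum_le_sum fun n hn => ?_
          exact avg_mul_cls_mul_cls_le hp hR hN hf0 hf hφ hφp hφ1 (Nat.dvd_of_mem_divisors hm)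
            (Nat.dvd_of_mem_divisors hn) (Nat.lt_succ_iff.1 (mem_range.1 hj))
            (Nat.lt_succ_iff.1 (mem_range.1 hk)) _ _
      _ = V * ∑ j ∈ range (e + 1), ∑ k ∈ range (e + 1), pairFactor p j k := by
          simp only [← sum_mul, mul_comm V]
      _ ≤ _ := mul_le_mul_of_nonneg_left (sum_pairFactor_le hp1 e) hV0
  · have hBp := newlyCovered_periodic S a R (p ^ e)
    calc avg N (fun x => f x * φ x * covered S a (R * p ^ e) x)
        ≤ avg N (fun x => f x * φ x * covered S a R x +
            f x * (newlyCovered S a R (p ^ e) x * φ x)) := by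
          refine avg_mono fun x => ?_
          have := mul_le_mul_of_nonneg_left (covered_mul_le S a R (p ^ e) x) (hff0 x)
          linarith
      _ = avg N (fun x => f x * covered S a R x) +
            avg N (fun x => f x *
              fibreAvg R (p ^ e) (fun y => newlyCovered S a R (p ^ e) y * φ y) x) := by
          rw [avg_add, hpres _ (covered_periodic S a R),
            avg_mul_fibreAvg hq hf (g := fun x => newlyCovered S a R (p ^ e) x * φ x)
              (fun x => by simp only [hBp x, hφp x]) hN]
      _ ≤ σ + avg N (fun x => 4 / 3 *
            (f x * fibreAvg R (p ^ e) (newlyCovered S a R (p ^ e)) x ^ 2)) := by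
          refine add_le_add hσ (avg_mono fun x => ?_)
          have := mul_le_mul_of_nonneg_left (hφB x) (hf0 x)
          linarith
      _ ≤ _ := by
          rw [avg_const_mul]
          have := avg_mul_fibreAvg_newlyCovered_sq_le (S := S) (a := a) (e := e) hp hR hf0 hV
          linarith

/-- Upper bound for the mass of pairs of classes after treating all primes below `n`. -/
noncomputable def massBound : ℕ → ℝ
  | 0 => 1
  | n + 1 => if n.Prime ∧ 5 ≤ n then
      massBound n * (1 + 4 / 3 * ((3 * n - 1) / ((n : ℝ) - 1) ^ 2)) else massBound n

/-- Upper bound for the mass of the covered set after treating all primes below `n`. -/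
noncomputable def coverBound : ℕ → ℝ
  | 0 => 0
  | n + 1 => if n.Prime ∧ 5 ≤ n then
      coverBound n + 4 / 3 * (massBound n / ((n : ℝ) - 1) ^ 2) else coverBound n

lemma massBound_pos (n : ℕ) : 0 < massBound n := by
  induction n with
  | zero => simp [massBound]
  | succ n ih =>
    rw [massBound]
    split_ifs with h
    · have : (5 : ℝ) ≤ n := by exact_mod_cast h.2
      have : 0 ≤ (3 * n - 1) / ((n : ℝ) - 1) ^ 2 := div_nonneg (by linarith) (sq_nonneg _)
      positivity
    · exact ih

lemma coverBound_mono : Monotone coverBound := by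
  refine monotone_nat_of_le_succ fun n => ?_
  rw [coverBound]
  split_ifs
  · have := massBound_pos n
    have : 0 ≤ 4 / 3 * (massBound n / ((n : ℝ) - 1) ^ 2) := by positivity
    linarith
  · exact le_rfl

lemma hasDensity_one {S : Finset ℕ} (hS : ∀ m ∈ S, 1 < m) (a : ℕ → ℤ) {N : ℕ} (hN : N ≠ 0) :
    HasDensity S a N 1 1 0 := by
  refine ⟨fun _ => 1, fun _ => zero_le_one, fun _ => rfl, avg_const hN 1, fun b c => ?_, ?_⟩
  · have h : ∀ b x, cls 1 b x = 1 := fun b x => by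
      rw [cls, if_pos (by simpa using Int.modEq_one)]
    simp [h, avg_const hN]
  · have h : ∀ x, covered S a 1 x = 0 := fun x => by
      rw [covered, if_neg]
      rintro ⟨d, hd, h1, -⟩
      have := hS d hd
      rw [Nat.dvd_one] at h1
      omega
    simp [h, avg_const hN]

lemma prod_primesBelow_eq {N n : ℕ} (hN : N ≠ 0) (hn : N < n) :
    ∏ p ∈ n.primesBelow, p ^ N.factorization p = N := by
  conv_rhs => rw [← Nat.prod_factorization_pow_eq_self hN]
  refine (Finsupp.prod_of_support_subset _ (fun p hp => ?_) _ (fun p _ => pow_zero p)).symm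
  rw [Nat.support_factorization] at hp
  exact Nat.mem_primesBelow.2 ⟨(Nat.le_of_mem_primeFactors hp).trans_lt hn,
    Nat.prime_of_mem_primeFactors hp⟩

lemma prod_primesBelow_dvd {N : ℕ} (hN : N ≠ 0) (n : ℕ) :
    ∏ p ∈ n.primesBelow, p ^ N.factorization p ∣ N := by
  conv_rhs => rw [← prod_primesBelow_eq hN (by omega : N < n + N + 1)]
  exact prod_dvd_prod_of_subset _ _ _ (Nat.primesBelow_mono (by omega))

lemma hasDensity_prod_primesBelow {S : Finset ℕ} (hS : ∀ m ∈ S, 1 < m) (a : ℕ → ℤ) {N : ℕ}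
    (hN : N ≠ 0) (h2 : ¬ 2 ∣ N) (h3 : ¬ 3 ∣ N) (n : ℕ) :
    HasDensity S a N (∏ p ∈ n.primesBelow, p ^ N.factorization p) (massBound n)
      (coverBound n) := by
  induction n with
  | zero => simpa [massBound, coverBound] using hasDensity_one hS a hN
  | succ n ih =>
    have hdvd := prod_primesBelow_dvd hN (n + 1)
    rw [massBound, coverBound]
    rw [Nat.primesBelow_succ] at hdvd ⊢
    by_cases hn : n.Prime
    · rw [if_pos hn, prod_insert (Nat.notMem_primesBelow n), mul_comm] at hdvd ⊢
      by_cases h5 : 5 ≤ n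
      · rw [if_pos ⟨hn, h5⟩, if_pos ⟨hn, h5⟩]
        refine ih.mul_prime_pow hn (fun h => ?_) hdvd
        obtain ⟨p, hp, hpn⟩ := (hn.prime.dvd_finsetProd_iff _).1 h
        have := (Nat.prime_dvd_prime_iff_eq hn (Nat.prime_of_mem_primesBelow hp)).1
          (hn.dvd_of_dvd_pow hpn)
        exact (this ▸ Nat.lt_of_mem_primesBelow hp).false
      · rw [if_neg (fun h => h5 h.2), if_neg (fun h => h5 h.2)]
        have : ¬ n ∣ N := by
          have := hn.two_le
          interval_cases n
          · exact h2
          · exact h3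
          · exact absurd hn (by norm_num)
        rwa [Nat.factorization_eq_zero_of_not_dvd this, pow_zero, mul_one]
    · rw [if_neg hn, if_neg (fun h => hn h.1), if_neg (fun h => hn h.1)]
      exact ih

/-- The number of primes in `[A, A + j)`. -/
def primesFrom (A j : ℕ) : ℕ := #{p ∈ Ico A (A + j) | p.Prime}

lemma primesFrom_succ (A j : ℕ) :
    primesFrom A (j + 1) = primesFrom A j + if (A + j).Prime then 1 else 0 := by
  unfold primesFrom
  rw [← add_assoc, ← insert_Ico_right_eq_Ico_add_one (Nat.le_add_right A j), filter_insert]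
  split_ifs
  · rw [card_insert_of_notMem (by simp)]
  · rfl

lemma primesFrom_mono (A : ℕ) : Monotone (primesFrom A) :=
  monotone_nat_of_le_succ fun j => by rw [primesFrom_succ]; omega

lemma primesFrom_two_pow_mul_le {k : ℕ} (hk : 2 ≤ k) :
    primesFrom (2 ^ k) (2 ^ k) * k ≤ 2 * 2 ^ k := by
  set A := 2 ^ k with hA
  have hAk : 4 ≤ A := (by norm_num : 4 = 2 ^ 2) ▸ Nat.pow_le_pow_right (by norm_num) hk
  have hnp : ∀ i, 2 ≤ i → ¬ (2 ^ i).Prime := fun i hi => Nat.Prime.not_prime_pow hi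
  have hset : {p ∈ Ico A (A + A) | p.Prime} = {p ∈ Ico (A + 1) (A + A + 1) | p.Prime} := by
    ext p
    simp only [mem_filter, mem_Ico]
    have h1 : p.Prime → p ≠ A := fun hp h => hnp k hk (by rw [← hA, ← h]; exact hp)
    have h2 : p.Prime → p ≠ A + A := fun hp h => hnp (k + 1) (by omega) (by
      rw [pow_succ, mul_two, ← hA, ← h]; exact hp)
    constructor <;> rintro ⟨⟨h3, h4⟩, hp⟩ <;> have := h1 hp <;> have := h2 hp <;>
      exact ⟨by omega, hp⟩
  have hprod : ∏ p ∈ Ico (A + 1) (A + A + 1) with p.Prime, p ≤ 4 ^ A := by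
    have h1 := primorial_add A A
    have h2 := primorial_add_le (le_refl A)
    rw [h1] at h2
    refine (Nat.le_of_mul_le_mul_left h2 (primorial_pos A)).trans ?_
    rw [← two_mul]
    exact (Nat.choose_le_two_pow _ _).trans (by rw [pow_mul]; norm_num)
  have hpow : A ^ primesFrom A A ≤ ∏ p ∈ Ico (A + 1) (A + A + 1) with p.Prime, p := by
    rw [primesFrom, hset]
    exact pow_card_le_prod _ _ _ fun p hp => by
      have := (mem_Ico.1 (mem_filter.1 hp).1).1; omega
  have h := hpow.trans hprod
  have h4 : 4 ^ A = 2 ^ (2 * A) := by rw [pow_mul]; norm_num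
  rw [h4, hA, ← pow_mul, Nat.pow_le_pow_iff_right (by norm_num)] at h
  rw [mul_comm]
  exact h

lemma massBound_add_le {A : ℕ} (hA : 5 ≤ A) (j : ℕ) :
    massBound (A + j) ≤
      massBound A * (1 + 4 / 3 * ((3 * A - 1) / ((A : ℝ) - 1) ^ 2)) ^ primesFrom A j := by
  have hA' : (5 : ℝ) ≤ A := by exact_mod_cast hA
  have h0 : 0 ≤ (3 * A - 1) / ((A : ℝ) - 1) ^ 2 := div_nonneg (by linarith) (sq_nonneg _)
  induction j with
  | zero => simp [primesFrom]
  | succ j ih =>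
    rw [← add_assoc, massBound, primesFrom_succ]
    by_cases hp : (A + j).Prime
    · rw [if_pos ⟨hp, by omega⟩, if_pos hp,
        pow_succ (1 + 4 / 3 * ((3 * A - 1) / ((A : ℝ) - 1) ^ 2)) (primesFrom A j),
        ← mul_assoc (massBound A)]
      have hj : (0 : ℝ) ≤ j := Nat.cast_nonneg j
      have h1 : (3 * ((A + j : ℕ) : ℝ) - 1) / (((A + j : ℕ) : ℝ) - 1) ^ 2 ≤
          (3 * A - 1) / ((A : ℝ) - 1) ^ 2 := by
        push_cast
        rw [div_le_div_iff₀ (pow_pos (by linarith) 2) (pow_pos (by linarith) 2)]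
        nlinarith [mul_nonneg hj hj, mul_nonneg hj (by linarith : (0 : ℝ) ≤ A - 5),
          mul_nonneg (mul_nonneg hj hj) (by linarith : (0 : ℝ) ≤ A - 5),
          mul_nonneg hj (mul_self_nonneg ((A : ℝ) - 5))]
      have hn : 0 ≤ (3 * ((A + j : ℕ) : ℝ) - 1) / (((A + j : ℕ) : ℝ) - 1) ^ 2 :=
        div_nonneg (by push_cast; linarith) (sq_nonneg _)
      refine mul_le_mul ih (by linarith) (by linarith) ?_
      have := massBound_pos A
      positivity
    · rw [if_neg (fun h => hp h.1), if_neg hp]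
      exact ih

lemma coverBound_add_le {A B : ℕ} (hA : 5 ≤ A) {r : ℝ} (hr : 0 ≤ r)
    (h : ∀ j ≤ B, massBound (A + j) ≤ r) {j : ℕ} (hj : j ≤ B) :
    coverBound (A + j) ≤ coverBound A + 4 / 3 * (r / ((A : ℝ) - 1) ^ 2) * primesFrom A j := by
  have hA' : (5 : ℝ) ≤ A := by exact_mod_cast hA
  induction j with
  | zero => simp [primesFrom]
  | succ j ih =>
    have ih := ih (by omega)
    rw [← add_assoc, coverBound, primesFrom_succ]
    by_cases hp : (A + j).Prime
    · rw [if_pos ⟨hp, by omega⟩, if_pos hp]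
      have hj' : (0 : ℝ) ≤ j := Nat.cast_nonneg j
      have h1 : massBound (A + j) / (((A + j : ℕ) : ℝ) - 1) ^ 2 ≤ r / ((A : ℝ) - 1) ^ 2 := by
        refine div_le_div₀ hr (h j (by omega)) (pow_pos (by linarith) 2) ?_
        refine pow_le_pow_left₀ (by linarith) ?_ 2
        push_cast
        linarith
      push_cast at h1 ⊢
      linarith
    · rw [if_neg (fun h => hp h.1), if_neg hp]
      simpa using ih

lemma exp_lt_of_le {x : ℝ} (hx : x ≤ 534 / 1000) : Real.exp x ≤ 172 / 100 := by
  have h1 : Real.exp (-(534 / 32000 : ℝ)) ≥ 1 - 534 / 32000 := by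
    have := Real.add_one_le_exp (-(534 / 32000 : ℝ))
    linarith
  have h2 : Real.exp (534 / 1000 : ℝ) * Real.exp (-(534 / 32000 : ℝ)) ^ 32 = 1 := by
    rw [← Real.exp_nat_mul, ← Real.exp_add]
    norm_num
  have h3 : (100 / 172 : ℝ) ≤ Real.exp (-(534 / 32000 : ℝ)) ^ 32 :=
    le_trans (by norm_num) (pow_le_pow_left₀ (by norm_num) h1 32)
  refine (Real.exp_le_exp.2 hx).trans ?_
  nlinarith [Real.exp_pos (534 / 1000 : ℝ)]

/-- Passing from `2 ^ k` to `2 ^ (k + 1)` does not increase this potential. -/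
lemma potential_succ_le {k : ℕ} (hk : 15 ≤ k) :
    coverBound (2 ^ (k + 1)) + massBound (2 ^ (k + 1)) * (22 / 10) / 2 ^ (k + 1) ≤
      coverBound (2 ^ k) + massBound (2 ^ k) * (22 / 10) / 2 ^ k := by
  have hcount := primesFrom_two_pow_mul_le (k := k) (by omega)
  have hA : 2 ^ 15 ≤ 2 ^ k := Nat.pow_le_pow_right (by norm_num) hk
  have hsucc : 2 ^ (k + 1) = 2 ^ k + 2 ^ k := by ring
  have hcast : (2 : ℝ) ^ (k + 1) = 2 * 2 ^ k := by ring
  have hcast' : ((2 ^ k : ℕ) : ℝ) = 2 ^ k := by push_cast; rfl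
  rw [hsucc, hcast, ← hcast']
  generalize 2 ^ k = A at *
  have hA' : (32768 : ℝ) ≤ A := by exact_mod_cast hA
  have hA1 : (0 : ℝ) < (A - 1) ^ 2 := pow_pos (by linarith) 2
  set c := primesFrom A A with hc
  have hc15 : (c : ℝ) * 15 ≤ 2 * A := by
    exact_mod_cast (Nat.mul_le_mul_left c hk).trans hcount
  have hM := massBound_pos A
  have hε0 : 0 ≤ 4 / 3 * ((3 * A - 1) / ((A : ℝ) - 1) ^ 2) :=
    mul_nonneg (by norm_num) (div_nonneg (by linarith) hA1.le)
  have hr : (1 + 4 / 3 * ((3 * A - 1) / ((A : ℝ) - 1) ^ 2)) ^ c ≤ 172 / 100 := by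
    refine (pow_le_pow_left₀ (by linarith) ((add_comm _ _).trans_le
      (Real.add_one_le_exp _)) c).trans ?_
    rw [← Real.exp_nat_mul]
    refine exp_lt_of_le ?_
    have : (c : ℝ) * (4 / 3 * ((3 * A - 1) / ((A : ℝ) - 1) ^ 2)) ≤
        2 * A / 15 * (4 / 3 * ((3 * A - 1) / ((A : ℝ) - 1) ^ 2)) :=
      mul_le_mul_of_nonneg_right (by linarith) hε0
    refine this.trans ?_
    rw [mul_div_assoc', mul_div_assoc', div_le_iff₀ hA1]
    nlinarith
  have hmass : ∀ j ≤ A, massBound (A + j) ≤ massBound A * (172 / 100) := fun j hj => by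
    refine (massBound_add_le (by omega) j).trans (mul_le_mul_of_nonneg_left ?_ hM.le)
    exact (pow_le_pow_right₀ (by linarith) (primesFrom_mono A hj)).trans hr
  have h1 := coverBound_add_le (by omega) (by positivity) hmass le_rfl
  have h2 := hmass A le_rfl
  have h3 : 4 / 3 * (massBound A * (172 / 100) / ((A : ℝ) - 1) ^ 2) * c ≤
      massBound A * (308 / 1000) / A := by
    have hq : 4 / 3 * (172 / 100) / ((A : ℝ) - 1) ^ 2 * c ≤ 308 / 1000 / A := by
      rw [div_mul_eq_mul_div, div_le_div_iff₀ hA1 (by linarith)]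
      nlinarith
    calc _ = massBound A * (4 / 3 * (172 / 100) / ((A : ℝ) - 1) ^ 2 * c) := by ring
      _ ≤ massBound A * (308 / 1000 / A) := mul_le_mul_of_nonneg_left hq hM.le
      _ = _ := by ring
  have h4 : massBound (A + A) * (22 / 10) / (2 * A) ≤ massBound A * (1892 / 1000) / A := by
    rw [div_le_div_iff₀ (by linarith) (by linarith)]
    nlinarith
  have h5 : massBound A * (308 / 1000) / A + massBound A * (1892 / 1000) / A =
      massBound A * (22 / 10) / A := by ring
  rw [← hc] at h1
  linarith

/-- Upper bounds for `massBound n` and `coverBound n`, scaled by `10 ^ 9`. -/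
def Bounded (n v s : ℕ) : Prop := massBound n ≤ v / 10 ^ 9 ∧ coverBound n ≤ s / 10 ^ 9

lemma Bounded.mono {n v v' s s' : ℕ} (h : Bounded n v s) (hv : v ≤ v') (hs : s ≤ s') :
    Bounded n v' s' := by
  have hv' : (v : ℝ) ≤ v' := by exact_mod_cast hv
  have hs' : (s : ℝ) ≤ s' := by exact_mod_cast hs
  exact ⟨h.1.trans (by gcongr), h.2.trans (by gcongr)⟩

lemma Bounded.succ_of_not_prime {n v s : ℕ} (h : Bounded n v s) (hn : ¬ n.Prime) :
    Bounded (n + 1) v s := by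
  unfold Bounded
  rw [massBound, coverBound, if_neg (fun h => hn h.1), if_neg (fun h => hn h.1)]
  exact h

lemma cast_div_le (x y : ℕ) : (x : ℝ) / y ≤ ((x / y : ℕ) : ℝ) + 1 := by
  have := (Nat.lt_floor_add_one ((x : ℝ) / y)).le
  rwa [Nat.floor_div_eq_div] at this

lemma Bounded.succ {n v s : ℕ} (h : Bounded n v s) (hn : 5 ≤ n) :
    Bounded (n + 1) (v + v * (4 * (3 * n - 1)) / (3 * (n - 1) ^ 2) + 1)
      (s + v * 4 / (3 * (n - 1) ^ 2) + 1) := by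
  by_cases hp : n.Prime
  · obtain ⟨hv, hs⟩ := h
    have hn' : (5 : ℝ) ≤ n := by exact_mod_cast hn
    have hn1 : (n : ℝ) - 1 ≠ 0 := by linarith
    unfold Bounded
    rw [massBound, coverBound, if_pos ⟨hp, hn⟩, if_pos ⟨hp, hn⟩]
    have h1 := cast_div_le (v * (4 * (3 * n - 1))) (3 * (n - 1) ^ 2)
    have h2 := cast_div_le (v * 4) (3 * (n - 1) ^ 2)
    rw [Nat.cast_mul, Nat.cast_mul, Nat.cast_mul, Nat.cast_pow, Nat.cast_sub (by omega),
      Nat.cast_sub (by omega), Nat.cast_mul] at h1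
    rw [Nat.cast_mul, Nat.cast_mul, Nat.cast_pow, Nat.cast_sub (by omega)] at h2
    push_cast at h1 h2 ⊢
    constructor
    · calc massBound n * (1 + 4 / 3 * ((3 * n - 1) / ((n : ℝ) - 1) ^ 2))
          ≤ v / 10 ^ 9 * (1 + 4 / 3 * ((3 * n - 1) / ((n : ℝ) - 1) ^ 2)) := by
            refine mul_le_mul_of_nonneg_right hv ?_
            have : 0 ≤ (3 * n - 1) / ((n : ℝ) - 1) ^ 2 := div_nonneg (by linarith) (sq_nonneg _)
            positivity
        _ = (v + v * (4 * (3 * n - 1)) / (3 * ((n : ℝ) - 1) ^ 2)) / 10 ^ 9 := by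
            field_simp
        _ ≤ _ := by
            refine div_le_div_of_nonneg_right ?_ (by norm_num)
            linarith
    · calc coverBound n + 4 / 3 * (massBound n / ((n : ℝ) - 1) ^ 2)
          ≤ s / 10 ^ 9 + 4 / 3 * (v / 10 ^ 9 / ((n : ℝ) - 1) ^ 2) := by gcongr
        _ = (s + v * 4 / (3 * ((n : ℝ) - 1) ^ 2)) / 10 ^ 9 := by
            field_simp
        _ ≤ _ := by
            refine div_le_div_of_nonneg_right ?_ (by norm_num)
            linarith
  · refine (h.succ_of_not_prime hp).mono ?_ ?_
    · rw [add_assoc]; exact Nat.le_add_right _ _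
    · rw [add_assoc]; exact Nat.le_add_right _ _

/-- The odd numbers `n` from `M - 2 * k` to `M - 2` are run through an integer version, scaled by
`10 ^ 9`, of the recursions for `massBound` and `coverBound`, starting from `v` and `s`; the
outcome is compared with `v'` and `s'`. Numbers without prime factor at most `13` (at most `191`
from `192` on) are treated like primes. Matching on the new values makes the kernel evaluate
them. -/
def sieveCheck (M k v' s' : ℕ) : ℕ → ℕ → Bool :=
  Nat.rec
    (fun v s => Nat.ble v v' && Nat.ble s s')
    (fun j ih v s =>
      cond (Nat.beq (Nat.gcd (M - 2 - 2 * j) (cond (Nat.ble 192 (M - 2 - 2 * j))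
          1030893141925860008499560888835674370998623848299590975192766715520279329390
          30030)) 1)
        (Nat.casesOn (v + v * (4 * (3 * (M - 2 - 2 * j) - 1)) / (3 * (M - 2 - 2 * j - 1) ^ 2))
          false (fun v₁ => Nat.casesOn (s + v * 4 / (3 * (M - 2 - 2 * j - 1) ^ 2))
            false (fun s₁ => ih (v₁ + 2) (s₁ + 2))))
        (ih v s))
    k

lemma gcd_eq_one_of_prime {p : ℕ} (hp : p.Prime) (h : 17 ≤ p) :
    Nat.gcd p (cond (Nat.ble 192 p)
      1030893141925860008499560888835674370998623848299590975192766715520279329390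
      30030) = 1 := by
  have key : ∀ l : List ℕ, (∀ q ∈ l, 0 < q ∧ q < p) → Nat.gcd p l.prod = 1 := by
    intro l hl
    refine (hp.coprime_iff_not_dvd).2 fun hdvd => ?_
    obtain ⟨q, hq, hpq⟩ := (hp.prime.dvd_prod_iff).1 hdvd
    exact (Nat.le_of_dvd (hl q hq).1 hpq).not_gt (hl q hq).2
  cases h192 : Nat.ble 192 p
  · have := key [2, 3, 5, 7, 11, 13] (fun q hq => by simp at hq; omega)
    norm_num at this
    exact this
  · have h192 := Nat.le_of_ble_eq_true h192
    have hlt : ∀ q ∈ [2, 3, 5, 7, 11, 13, 17, 19, 23, 29, 31, 37, 41, 43, 47, 53, 59, 61, 67, 71,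
        73, 79, 83, 89, 97, 101, 103, 107, 109, 113, 127, 131, 137, 139, 149, 151, 157, 163, 167,
        173, 179, 181, 191],
        0 < q ∧ q < 192 := by decide
    have := key _ (fun q hq => ⟨(hlt q hq).1, (hlt q hq).2.trans_le h192⟩)
    norm_num at this
    exact this

lemma Bounded.of_sieveCheck {M k v s v' s' n : ℕ} (h : Bounded n v s) (hM : M % 2 = 1)
    (hn : n + 2 * k = M ∧ 17 ≤ n) (hc : sieveCheck M k v' s' v s = true) : Bounded M v' s' := by
  induction k generalizing n v s with
  | zero =>
    obtain rfl : n = M := by omega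
    change (Nat.ble v v' && Nat.ble s s') = true at hc
    rw [Bool.and_eq_true, Nat.ble_eq, Nat.ble_eq] at hc
    exact h.mono hc.1 hc.2
  | succ k ih =>
    have hMn : M - 2 - 2 * k = n := by omega
    have hn1 : ¬ (n + 1).Prime := fun hp => by
      have := hp.eq_two_or_odd
      omega
    change cond (Nat.beq (Nat.gcd (M - 2 - 2 * k) _) 1) _
      (sieveCheck M k v' s' v s) = true at hc
    rw [hMn] at hc
    cases hg : Nat.beq (Nat.gcd n (cond (Nat.ble 192 n)
      1030893141925860008499560888835674370998623848299590975192766715520279329390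
      30030)) 1
    · rw [hg] at hc
      have hp : ¬ n.Prime := fun hp => by
        rw [gcd_eq_one_of_prime hp hn.2] at hg
        exact absurd hg (by decide)
      exact ih ((h.succ_of_not_prime hp).succ_of_not_prime hn1) (by omega) hc
    · rw [hg] at hc
      have h' := (h.succ (by omega)).succ_of_not_prime hn1
      rcases hv : v + v * (4 * (3 * n - 1)) / (3 * (n - 1) ^ 2) with _ | v₁
      · rw [hv] at hc
        exact absurd hc (by simp)
      · rcases hs : s + v * 4 / (3 * (n - 1) ^ 2) with _ | s₁
        · rw [hv, hs] at hc
          exact absurd hc (by simp)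
        · rw [hv, hs] at hc h'
          exact ih h' (by omega) hc

lemma bounded_seventeen : Bounded 17 7274075599 263690749 := by
  constructor <;> norm_num [massBound, coverBound]

lemma coverBound_two_pow_add_lt :
    coverBound (2 ^ 15) + massBound (2 ^ 15) * (22 / 10) / 2 ^ 15 < 1 := by
  have h2065 : Bounded 2065 321850801827 780884324 := bounded_seventeen.of_sieveCheck (k := 1024)
    (by decide) (by norm_num) (by decide +kernel)
  have h4113 : Bounded 4113 454241071401 796097620 := h2065.of_sieveCheck (k := 1024)
    (by decide) (by norm_num) (by decide +kernel)
  have h6161 : Bounded 6161 547255291517 802261581 := h4113.of_sieveCheck (k := 1024)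
    (by decide) (by norm_num) (by decide +kernel)
  have h8209 : Bounded 8209 621422793955 805751084 := h6161.of_sieveCheck (k := 1024)
    (by decide) (by norm_num) (by decide +kernel)
  have h10257 : Bounded 10257 686608999762 808123024 := h8209.of_sieveCheck (k := 1024)
    (by decide) (by norm_num) (by decide +kernel)
  have h12305 : Bounded 12305 740860786030 809732536 := h10257.of_sieveCheck (k := 1024)
    (by decide) (by norm_num) (by decide +kernel)
  have h14353 : Bounded 14353 789753738408 810962324 := h12305.of_sieveCheck (k := 1024)
    (by decide) (by norm_num) (by decide +kernel)
  have h16401 : Bounded 16401 835770372508 811964059 := h14353.of_sieveCheck (k := 1024)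
    (by decide) (by norm_num) (by decide +kernel)
  have h18449 : Bounded 18449 877649014676 812765836 := h16401.of_sieveCheck (k := 1024)
    (by decide) (by norm_num) (by decide +kernel)
  have h20497 : Bounded 20497 914408584006 813394739 := h18449.of_sieveCheck (k := 1024)
    (by decide) (by norm_num) (by decide +kernel)
  have h22545 : Bounded 22545 950288781055 813951046 := h20497.of_sieveCheck (k := 1024)
    (by decide) (by norm_num) (by decide +kernel)
  have h24593 : Bounded 24593 983978747280 814428443 := h22545.of_sieveCheck (k := 1024)
    (by decide) (by norm_num) (by decide +kernel)
  have h26641 : Bounded 26641 1014408175126 814824721 := h24593.of_sieveCheck (k := 1024)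
    (by decide) (by norm_num) (by decide +kernel)
  have h28689 : Bounded 28689 1044932162609 815192796 := h26641.of_sieveCheck (k := 1024)
    (by decide) (by norm_num) (by decide +kernel)
  have h30737 : Bounded 30737 1072021818210 815497077 := h28689.of_sieveCheck (k := 1024)
    (by decide) (by norm_num) (by decide +kernel)
  have h32769 : Bounded 32769 1098967148487 815780192 := h30737.of_sieveCheck (k := 1016)
    (by decide) (by norm_num) (by decide +kernel)
  have hp : ¬ (32768 : ℕ).Prime := by norm_num
  obtain ⟨hv, hs⟩ := h32769
  rw [massBound, if_neg (fun h => hp h.1)] at hv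
  rw [coverBound, if_neg (fun h => hp h.1)] at hs
  norm_num at hv hs ⊢
  linarith

lemma coverBound_lt_one (n : ℕ) : coverBound n < 1 := by
  have h : ∀ k, coverBound (2 ^ (15 + k)) +
      massBound (2 ^ (15 + k)) * (22 / 10) / 2 ^ (15 + k) < 1 := fun k => by
    induction k with
    | zero => exact coverBound_two_pow_add_lt
    | succ k ih => exact (potential_succ_le (k := 15 + k) (Nat.le_add_right 15 k)).trans_lt ih
  have hn : n ≤ 2 ^ (15 + n) :=
    Nat.lt_two_pow_self.le.trans (Nat.pow_le_pow_right (by norm_num) (by omega))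
  have := massBound_pos (2 ^ (15 + n))
  have h1 : 0 < massBound (2 ^ (15 + n)) * (22 / 10) / 2 ^ (15 + n) := by positivity
  linarith [h n, coverBound_mono hn]

/-- **Hough–Nielsen.** Every covering system of the integers has a modulus
divisible by `2` or by `3`. -/
theorem covering_has_modulus_div_two_or_three
    (S : Finset ℕ) (hS : ∀ m ∈ S, 1 < m) (a : ℕ → ℤ)
    (hcov : ∀ n : ℤ, ∃ m ∈ S, n ≡ a m [ZMOD (m : ℤ)]) :
    ∃ m ∈ S, 2 ∣ m ∨ 3 ∣ m := by
  by_contra! hcon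
  have hN : ∏ m ∈ S, m ≠ 0 := prod_ne_zero_iff.2 fun m hm => by have := hS m hm; omega
  have hq : ∀ q, q.Prime → q ∣ ∏ m ∈ S, m → ∃ m ∈ S, q ∣ m := fun q hq h =>
    (hq.prime.dvd_finsetProd_iff _).1 h
  have h2 : ¬ 2 ∣ ∏ m ∈ S, m := fun h => by
    obtain ⟨m, hm, h⟩ := hq 2 Nat.prime_two h
    exact (hcon m hm).1 h
  have h3 : ¬ 3 ∣ ∏ m ∈ S, m := fun h => by
    obtain ⟨m, hm, h⟩ := hq 3 Nat.prime_three h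
    exact (hcon m hm).2 h
  have hdens := hasDensity_prod_primesBelow hS a hN h2 h3 (∏ m ∈ S, m + 1)
  rw [prod_primesBelow_eq hN (Nat.lt_succ_self _)] at hdens
  obtain ⟨f, -, -, hf, -, hσ⟩ := hdens
  have hall : ∀ x, covered S a (∏ m ∈ S, m) x = 1 := fun x => by
    obtain ⟨m, hm, hx⟩ := hcov x
    rw [covered, if_pos ⟨m, hm, dvd_prod_of_mem _ hm, hx⟩]
  simp only [hall, mul_one, hf] at hσ
  exact (hσ.trans_lt (coverBound_lt_one _)).false
end

section
/- The product over all primes p with 353 < p ≤ e^{11} of (1 + 1/(p−1)), minus 1, is strictly less than 0.86. In symbols: ∏_{p prime, 353 < p ≤ e^{11}} (1 + 1/(p−1)) − 1 < 0.86. -/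
/-- The sum of `f` over the `2 ^ d` consecutive integers starting at `a`, computed by bisection. -/
def dyadicSum (f : ℕ → ℕ) : ℕ → ℕ → ℕ
  | 0, a => f a
  | d + 1, a => dyadicSum f d a + dyadicSum f d (a + 2 ^ d)

theorem dyadicSum_eq_sum (f : ℕ → ℕ) (d a : ℕ) :
    dyadicSum f d a = ∑ n ∈ Finset.Ico a (a + 2 ^ d), f n := by
  induction d generalizing a with
  | zero => simp [dyadicSum]
  | succ d ih =>
    rw [dyadicSum, ih, ih, Finset.sum_Ico_consecutive _ (Nat.le_add_right _ _)
      (Nat.le_add_right _ _), pow_succ]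
    congr 2
    omega

/-- An integer upper bound for `10 ^ 12 / (n - 1)` if `n ≤ N` is coprime to `M`, and `0` otherwise. -/
def coprimeWeight (M N n : ℕ) : ℕ :=
  bif ((n.gcd M).beq 1).and (n.ble N) then 10 ^ 12 / (n - 1) + 1 else 0

theorem one_div_sub_one_le_coprimeWeight {M N n : ℕ} (hn : 1 < n) (hN : n ≤ N)
    (hM : n.Coprime M) : 1 / ((n : ℝ) - 1) ≤ (coprimeWeight M N n : ℝ) / 10 ^ 12 := by
  obtain ⟨m, rfl⟩ : ∃ m, n = m + 1 := ⟨n - 1, by omega⟩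
  have hm : (0 : ℝ) < m := by exact_mod_cast (by omega : 0 < m)
  have h : (10 : ℝ) ^ 12 / m ≤ ((10 ^ 12 / m + 1 : ℕ) : ℝ) := by
    rw [div_le_iff₀ hm, mul_comm]
    exact_mod_cast (Nat.lt_mul_div_succ (10 ^ 12) (by exact_mod_cast hm)).le
  have hw : coprimeWeight M N (m + 1) = 10 ^ 12 / m + 1 := by
    have hM' : (m + 1).gcd M = 1 := hM
    have hN' : (m + 1).ble N = true := Nat.ble_eq_true_of_le hN
    simp [coprimeWeight, hM', hN']
  rw [hw, le_div_iff₀ (by positivity)]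
  simpa [div_eq_inv_mul] using h

theorem prod_one_add_le_exp_sum {ι : Type*} (s : Finset ι) (f : ι → ℝ) (hf : ∀ i ∈ s, 0 ≤ f i) :
    ∏ i ∈ s, (1 + f i) ≤ Real.exp (∑ i ∈ s, f i) := by
  rw [Real.exp_sum]
  refine Finset.prod_le_prod (fun i hi => by linarith [hf i hi]) fun i _ => ?_
  linarith [Real.add_one_le_exp (f i)]

/-- The product of the primes up to `353`. -/
def primorial353 : ℕ :=
  92325987091692603167246758916442447848897069587880156248625475693453150629759757766750033011164044499544063264686235401999614947429856005620610

theorem Nat.Prime.coprime_primorial353 {p : ℕ} (hp : p.Prime) (h : 353 < p) :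
    p.Coprime primorial353 := by
  have hdvd : primorial353 ∣ Nat.factorial 353 := by decide +kernel
  refine hp.coprime_iff_not_dvd.2 fun hpM => ?_
  exact absurd (hp.dvd_factorial.1 (hpM.trans hdvd)) (by omega)

theorem dyadicSum_coprimeWeight_le :
    dyadicSum (coprimeWeight primorial353 59874) 16 0 ≤ 620370370370 := by
  decide +kernel

theorem exp_eleven_lt : Real.exp 11 < 59875 := by
  have h : Real.exp 11 = Real.exp 1 ^ 11 := by rw [← Real.exp_nat_mul]; norm_num
  rw [h]
  calc Real.exp 1 ^ 11 < 2.7182818286 ^ 11 := by gcongr; exact Real.exp_one_lt_d9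
    _ < 59875 := by norm_num

theorem exp_67_div_108_lt : Real.exp (67 / 108) < 1.86 := by
  refine lt_of_pow_lt_pow_left₀ 108 (by norm_num) ?_
  have h : Real.exp (67 / 108) ^ 108 = Real.exp 1 ^ 67 := by
    rw [← Real.exp_nat_mul, ← Real.exp_nat_mul]; norm_num
  rw [h]
  calc Real.exp 1 ^ 67 < 2.7182818286 ^ 67 := by gcongr; exact Real.exp_one_lt_d9
    _ < 1.86 ^ 108 := by norm_num


/-- The product over all primes `p` with `353 < p ≤ e^11` of `1 + 1/(p-1)`,
minus `1`, is strictly less than `0.86`. -/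
theorem prod_primes_353_to_exp11_lt :
    (∏ᶠ p ∈ {p : ℕ | p.Prime ∧ 353 < (p : ℝ) ∧ (p : ℝ) ≤ Real.exp 11},
      (1 + 1 / ((p : ℝ) - 1))) - 1 < 0.86 := by
  set S : Set ℕ := {p : ℕ | p.Prime ∧ 353 < (p : ℝ) ∧ (p : ℝ) ≤ Real.exp 11}
  have hS : ∀ p ∈ S, p.Prime ∧ 353 < p ∧ p ≤ 59874 := by
    rintro p ⟨hp, h₁, h₂⟩
    have h₃ : (p : ℝ) < 59875 := h₂.trans_lt exp_eleven_lt
    exact ⟨hp, by exact_mod_cast h₁, Nat.le_of_lt_succ (by exact_mod_cast h₃)⟩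
  have hfin : S.Finite := (Set.finite_Iic 59874).subset fun p hp => (hS p hp).2.2
  rw [finprod_mem_eq_finite_toFinset_prod _ hfin]
  have hsum : ∑ p ∈ hfin.toFinset, 1 / ((p : ℝ) - 1) ≤ 67 / 108 := by
    calc ∑ p ∈ hfin.toFinset, 1 / ((p : ℝ) - 1)
        ≤ ∑ p ∈ hfin.toFinset, (coprimeWeight primorial353 59874 p : ℝ) / 10 ^ 12 := by
          refine Finset.sum_le_sum fun p hp => ?_
          obtain ⟨hp, h₁, h₂⟩ := hS p (hfin.mem_toFinset.1 hp)
          exact one_div_sub_one_le_coprimeWeight hp.one_lt h₂ (hp.coprime_primorial353 h₁)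
      _ ≤ ∑ p ∈ Finset.Ico 0 (0 + 2 ^ 16), (coprimeWeight primorial353 59874 p : ℝ) / 10 ^ 12 := by
          refine Finset.sum_le_sum_of_subset_of_nonneg (fun p hp => ?_) fun _ _ _ => by positivity
          have := (hS p (hfin.mem_toFinset.1 hp)).2.2
          exact Finset.mem_Ico.2 ⟨by omega, by omega⟩
      _ = (dyadicSum (coprimeWeight primorial353 59874) 16 0 : ℝ) / 10 ^ 12 := by
          rw [dyadicSum_eq_sum, Nat.cast_sum, Finset.sum_div]
      _ ≤ (620370370370 : ℝ) / 10 ^ 12 := by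
          gcongr
          exact_mod_cast dyadicSum_coprimeWeight_le
      _ ≤ 67 / 108 := by norm_num
  have hprod := prod_one_add_le_exp_sum hfin.toFinset (fun p : ℕ => 1 / ((p : ℝ) - 1))
    fun p hp => by
      have hp := (hS p (hfin.mem_toFinset.1 hp)).1.one_le
      exact div_nonneg zero_le_one (sub_nonneg.2 (by exact_mod_cast hp))
  have hexp := Real.exp_le_exp.2 hsum
  linarith [exp_67_div_108_lt]
end

section
/- Let A = ∏_{p prime, 19 < p ≤ e^6} (1 + 1/(p−1)) and B = ∏_{p prime, 19 < p ≤ e^6} (1 + 7/(p−3)). Then A < 2, and ((2 − A)^{−1} · B)^{1/3} < 7.54. -/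
theorem setOf_prime_le_exp_six :
    {p : ℕ | p.Prime ∧ 19 < (p : ℝ) ∧ (p : ℝ) ≤ Real.exp 6} =
      ((Finset.Icc 20 403).filter Nat.Prime : Finset ℕ) := by
  have hexp : Real.exp 6 = Real.exp 1 ^ 6 := by
    rw [← Real.exp_nat_mul]
    norm_num
  have hlower : (403 : ℝ) ≤ Real.exp 6 := by
    have h := pow_le_pow_left₀ (by norm_num) Real.exp_one_gt_d9.le 6
    rw [hexp]
    exact le_trans (by norm_num) h
  have hupper : Real.exp 6 < 404 := by
    have h := pow_le_pow_left₀ (Real.exp_pos 1).le Real.exp_one_lt_d9.le 6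
    rw [hexp]
    exact lt_of_le_of_lt h (by norm_num)
  ext p
  simp only [Set.mem_ofPred_eq, Finset.coe_filter, Finset.mem_Icc]
  constructor
  · rintro ⟨hp, h₁, h₂⟩
    have h₃ : 19 < p := by exact_mod_cast h₁
    have h₄ : p < 404 := by exact_mod_cast h₂.trans_lt hupper
    exact ⟨by omega, hp⟩
  · rintro ⟨⟨h₁, h₂⟩, hp⟩
    have h₃ : (20 : ℝ) ≤ p := by exact_mod_cast h₁
    have h₄ : (p : ℝ) ≤ 403 := by exact_mod_cast h₂
    exact ⟨hp, by linarith, h₄.trans hlower⟩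

theorem prod_primes_rat_bounds :
    (∏ p ∈ (Finset.Icc 20 403).filter Nat.Prime, (1 + 1 / ((p : ℚ) - 1))) < 2 ∧
    (∏ p ∈ (Finset.Icc 20 403).filter Nat.Prime, (1 + 7 / ((p : ℚ) - 3))) <
      (754 / 100) ^ 3 *
        (2 - ∏ p ∈ (Finset.Icc 20 403).filter Nat.Prime, (1 + 1 / ((p : ℚ) - 1))) := by
  decide +kernel

/-- With `A = ∏_{19 < p ≤ e^6} (1 + 1/(p-1))` and `B = ∏_{19 < p ≤ e^6} (1 + 7/(p-3))`
(products over primes), we have `A < 2` and `((2 - A)⁻¹ · B)^{1/3} < 7.54`. -/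
theorem beta_three_zero_bound :
    (∏ᶠ p ∈ {p : ℕ | p.Prime ∧ 19 < (p : ℝ) ∧ (p : ℝ) ≤ Real.exp 6},
        (1 + 1 / ((p : ℝ) - 1))) < 2 ∧
    ((2 - ∏ᶠ p ∈ {p : ℕ | p.Prime ∧ 19 < (p : ℝ) ∧ (p : ℝ) ≤ Real.exp 6},
        (1 + 1 / ((p : ℝ) - 1)))⁻¹ *
      ∏ᶠ p ∈ {p : ℕ | p.Prime ∧ 19 < (p : ℝ) ∧ (p : ℝ) ≤ Real.exp 6},
        (1 + 7 / ((p : ℝ) - 3))) ^ ((1 : ℝ) / 3) < 7.54 := by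
  rw [setOf_prime_le_exp_six, finprod_mem_coe_finset, finprod_mem_coe_finset]
  obtain ⟨hA, hB⟩ := prod_primes_rat_bounds
  have hA' := (Rat.cast_lt (K := ℝ)).mpr hA
  have hB' := (Rat.cast_lt (K := ℝ)).mpr hB
  push_cast at hA' hB'
  have hB₀ : 0 ≤ ∏ p ∈ (Finset.Icc 20 403).filter Nat.Prime, (1 + 7 / ((p : ℝ) - 3)) := by
    refine Finset.prod_nonneg fun p hp => ?_
    have h : (20 : ℝ) ≤ p := by
      exact_mod_cast (Finset.mem_Icc.mp (Finset.mem_filter.mp hp).1).1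
    have h' : (0 : ℝ) < p - 3 := by linarith
    positivity
  have hpos := sub_pos.mpr hA'
  refine ⟨hA', ?_⟩
  rw [one_div (3 : ℝ), Real.rpow_inv_lt_iff_of_pos
    (mul_nonneg (inv_nonneg.mpr hpos.le) hB₀) (by norm_num) (by norm_num),
    inv_mul_lt_iff₀ hpos]
  refine hB'.trans_eq ?_
  rw [mul_comm]
  norm_num
end

section
/- Let D = Σ_{p prime, e^6 < p ≤ e^7} 1/(p−1)³ and E = ∏_{p prime, e^6 < p ≤ e^7} (1 + 2/(p−1)). Then (1/4) · (1/2)^{1/3} · D^{−1/3} · E^{−1} ≥ 19. -/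
/-- The integers in `[404, 1096]` with no prime factor up to `31`; here `200560490130` is the
primorial of `31`. -/
def sievedInterval : Finset ℕ :=
  (Finset.Icc 404 1096).filter fun n => Nat.gcd n 200560490130 = 1

theorem exp_six_gt : (403 : ℝ) < Real.exp 6 := by
  have h : Real.exp 6 = Real.exp 1 ^ 6 := by rw [← Real.exp_nat_mul]; norm_num
  rw [h]
  calc (403 : ℝ) < 2.7182818283 ^ 6 := by norm_num
    _ < Real.exp 1 ^ 6 := by gcongr; exact Real.exp_one_gt_d9

theorem exp_six_lt : Real.exp 6 < 404 := by
  have h : Real.exp 6 = Real.exp 1 ^ 6 := by rw [← Real.exp_nat_mul]; norm_num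
  rw [h]
  calc Real.exp 1 ^ 6 < 2.7182818286 ^ 6 := by gcongr; exact Real.exp_one_lt_d9
    _ < (404 : ℝ) := by norm_num

theorem exp_seven_gt : (1096 : ℝ) < Real.exp 7 := by
  have h : Real.exp 7 = Real.exp 1 ^ 7 := by rw [← Real.exp_nat_mul]; norm_num
  rw [h]
  calc (1096 : ℝ) < 2.7182818283 ^ 7 := by norm_num
    _ < Real.exp 1 ^ 7 := by gcongr; exact Real.exp_one_gt_d9

theorem exp_seven_lt : Real.exp 7 < 1097 := by
  have h : Real.exp 7 = Real.exp 1 ^ 7 := by rw [← Real.exp_nat_mul]; norm_num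
  rw [h]
  calc Real.exp 1 ^ 7 < 2.7182818286 ^ 7 := by gcongr; exact Real.exp_one_lt_d9
    _ < (1097 : ℝ) := by norm_num

theorem prime_gcd_primorial {p : ℕ} (hp : p.Prime) (h : 31 < p) :
    Nat.gcd p 200560490130 = 1 := by
  refine (Nat.Prime.coprime_iff_not_dvd hp).2 fun hd => ?_
  rw [show 200560490130 = 2 * 3 * 5 * 7 * 11 * 13 * 17 * 19 * 23 * 29 * 31 by norm_num] at hd
  simp only [hp.dvd_mul] at hd
  rcases hd with (((((((((hd | hd) | hd) | hd) | hd) | hd) | hd) | hd) | hd) | hd) | hd <;>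
    · have := Nat.le_of_dvd (by norm_num) hd
      omega

theorem primes_subset_sievedInterval :
    {p : ℕ | p.Prime ∧ Real.exp 6 < (p : ℝ) ∧ (p : ℝ) ≤ Real.exp 7} ⊆ (sievedInterval : Set ℕ) := by
  rintro p ⟨hp, h6, h7⟩
  have h1 : 403 < p := by exact_mod_cast exp_six_gt.trans h6
  have h2 : p < 1097 := by exact_mod_cast h7.trans_lt exp_seven_lt
  simp only [sievedInterval, Finset.coe_filter, Finset.mem_Icc, Set.mem_ofPred_eq]
  exact ⟨by omega, prime_gcd_primorial hp (by omega)⟩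

theorem le_of_mem_sievedInterval {p : ℕ} (hp : p ∈ sievedInterval) : 404 ≤ p :=
  (Finset.mem_Icc.1 (Finset.mem_filter.1 hp).1).1

theorem sub_one_pos_of_mem_sievedInterval {p : ℕ} (hp : p ∈ sievedInterval) :
    (0 : ℝ) < (p : ℝ) - 1 := by
  have h : (404 : ℝ) ≤ p := by exact_mod_cast le_of_mem_sievedInterval hp
  linarith

theorem sum_div_sievedInterval_le :
    ∑ p ∈ sievedInterval, (10 ^ 14 / (p - 1) ^ 3 + 1) ≤ 42 * 10 ^ 6 := by
  decide +kernel

theorem prod_succ_sievedInterval_le :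
    100 * ∏ p ∈ sievedInterval, (p + 1) ≤ 136 * ∏ p ∈ sievedInterval, (p - 1) := by
  decide +kernel

theorem sum_sievedInterval_le :
    ∑ p ∈ sievedInterval, 1 / ((p : ℝ) - 1) ^ 3 ≤ 42 / 10 ^ 8 := by
  have hterm : ∀ p ∈ sievedInterval, 1 / ((p : ℝ) - 1) ^ 3 ≤
      ((10 ^ 14 / (p - 1) ^ 3 + 1 : ℕ) : ℝ) / 10 ^ 14 := by
    intro p hp
    have hpos := sub_one_pos_of_mem_sievedInterval hp
    have h1 : 1 ≤ p := le_trans (by norm_num) (le_of_mem_sievedInterval hp)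
    have h := Nat.lt_floor_add_one (((10 ^ 14 : ℕ) : ℝ) / (((p - 1) ^ 3 : ℕ) : ℝ))
    rw [Nat.floor_div_eq_div] at h
    push_cast [Nat.cast_sub h1] at h ⊢
    rw [le_div_iff₀ (by positivity), one_div_mul_eq_div]
    norm_num at h ⊢
    exact h.le
  refine (Finset.sum_le_sum hterm).trans ?_
  rw [← Finset.sum_div, ← Nat.cast_sum, div_le_iff₀ (by positivity)]
  have h : ((∑ p ∈ sievedInterval, (10 ^ 14 / (p - 1) ^ 3 + 1) : ℕ) : ℝ) ≤
      ((42 * 10 ^ 6 : ℕ) : ℝ) := Nat.cast_le.2 sum_div_sievedInterval_le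
  refine h.trans ?_
  norm_num

theorem prod_sievedInterval_le :
    ∏ p ∈ sievedInterval, (1 + 2 / ((p : ℝ) - 1)) ≤ 1.36 := by
  have hterm : ∀ p ∈ sievedInterval,
      1 + 2 / ((p : ℝ) - 1) = ((p + 1 : ℕ) : ℝ) / ((p - 1 : ℕ) : ℝ) := by
    intro p hp
    have hpos := sub_one_pos_of_mem_sievedInterval hp
    have h1 : 1 ≤ p := le_trans (by norm_num) (le_of_mem_sievedInterval hp)
    push_cast [Nat.cast_sub h1]
    field_simp
    ring
  have hden : (0 : ℝ) < ((∏ p ∈ sievedInterval, (p - 1) : ℕ) : ℝ) := by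
    refine Nat.cast_pos.2 (Finset.prod_pos fun p hp => ?_)
    have := le_of_mem_sievedInterval hp
    omega
  rw [Finset.prod_congr rfl hterm, Finset.prod_div_distrib, ← Nat.cast_prod, ← Nat.cast_prod,
    div_le_iff₀ hden]
  have h := (Nat.cast_le (α := ℝ)).2 prod_succ_sievedInterval_le
  rw [Nat.cast_mul, Nat.cast_mul] at h
  norm_num only [Nat.cast_ofNat] at h ⊢
  linarith

/-- With `D = Σ_{e^6 < p ≤ e^7} 1/(p-1)³` and `E = ∏_{e^6 < p ≤ e^7} (1 + 2/(p-1))`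
(over primes), we have `(1/4) · (1/2)^{1/3} · D^{-1/3} · E⁻¹ ≥ 19`. -/
theorem B_three_zero_bound :
    (1 / 4 : ℝ) * ((1 / 2 : ℝ) ^ ((1 : ℝ) / 3)) *
      (∑ᶠ p ∈ {p : ℕ | p.Prime ∧ Real.exp 6 < (p : ℝ) ∧ (p : ℝ) ≤ Real.exp 7},
        1 / ((p : ℝ) - 1) ^ 3) ^ (-(1 : ℝ) / 3) *
      (∏ᶠ p ∈ {p : ℕ | p.Prime ∧ Real.exp 6 < (p : ℝ) ∧ (p : ℝ) ≤ Real.exp 7},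
        (1 + 2 / ((p : ℝ) - 1)))⁻¹ ≥ 19 := by
  have hfin := sievedInterval.finite_toSet.subset primes_subset_sievedInterval
  have hsub : hfin.toFinset ⊆ sievedInterval := by
    simpa using primes_subset_sievedInterval
  rw [finsum_mem_eq_finite_toFinset_sum _ hfin, finprod_mem_eq_finite_toFinset_prod _ hfin]
  have hD : ∑ p ∈ hfin.toFinset, 1 / ((p : ℝ) - 1) ^ 3 ≤ 42 / 10 ^ 8 := by
    refine (Finset.sum_le_sum_of_subset_of_nonneg hsub fun p hp _ => ?_).trans ?_
    · have := sub_one_pos_of_mem_sievedInterval hp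
      positivity
    · exact sum_sievedInterval_le
  have hE : ∏ p ∈ hfin.toFinset, (1 + 2 / ((p : ℝ) - 1)) ≤ 1.36 := by
    refine (Finset.prod_le_prod_of_subset_of_one_le hsub (fun p hp => ?_) fun p hp _ => ?_).trans ?_
    · have := sub_one_pos_of_mem_sievedInterval (hsub hp)
      positivity
    · have := sub_one_pos_of_mem_sievedInterval hp
      have : 0 < 2 / ((p : ℝ) - 1) := by positivity
      linarith
    · exact prod_sievedInterval_le
  have hD0 : 0 < ∑ p ∈ hfin.toFinset, 1 / ((p : ℝ) - 1) ^ 3 := by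
    refine Finset.sum_pos (fun p hp => ?_) ⟨409, ?_⟩
    · have := sub_one_pos_of_mem_sievedInterval (hsub hp)
      positivity
    · simp only [Set.Finite.mem_toFinset, Set.mem_ofPred_eq]
      refine ⟨by norm_num, ?_, ?_⟩
      · push_cast; linarith [exp_six_lt]
      · push_cast; linarith [exp_seven_gt]
  have hE0 : 0 < ∏ p ∈ hfin.toFinset, (1 + 2 / ((p : ℝ) - 1)) := by
    refine Finset.prod_pos fun p hp => ?_
    have := sub_one_pos_of_mem_sievedInterval (hsub hp)
    positivity
  generalize ∑ p ∈ hfin.toFinset, 1 / ((p : ℝ) - 1) ^ 3 = D at *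
  generalize ∏ p ∈ hfin.toFinset, (1 + 2 / ((p : ℝ) - 1)) = E at *
  have key : (104 : ℝ) ≤ (1 / 2 : ℝ) ^ ((1 : ℝ) / 3) * D ^ (-(1 : ℝ) / 3) := by
    rw [neg_div, Real.rpow_neg hD0.le, ← Real.inv_rpow hD0.le,
      ← Real.mul_rpow (by norm_num) (by positivity)]
    have h : (104 : ℝ) = ((104 : ℝ) ^ 3) ^ ((1 : ℝ) / 3) := by
      rw [← Real.rpow_natCast, ← Real.rpow_mul (by norm_num)]
      norm_num
    rw [h]
    refine Real.rpow_le_rpow (by norm_num) ?_ (by norm_num)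
    rw [← div_eq_mul_inv, le_div_iff₀ hD0]
    nlinarith
  rw [ge_iff_le, ← div_eq_mul_inv, le_div_iff₀ hE0, mul_assoc]
  linarith
end
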